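/- arXiv:1811.03570 — 2 statements merged into one kernel-verified Lean document; each statement's English description precedes it below -/
import Mathlib

section
/- Let E be a real inner product space, let x₁, …, x_n be points of E, and suppose z ∈ E is a local minimizer of the function j(w) = Σ_{i=1}^n ‖x_i − w‖ with z ≠ x_i for every i. Then Σ_{i=1}^n (x_i − z)/‖x_i − z‖ = 0, i.e., the unit vectors pointing from z to the points x_i sum to zero. -/
open RealInnerProductSpace

/-- Away from `a`, the distance to `a` has gradient the unit vector pointing away from `a`. -/
theorem hasFDerivAt_norm_const_sub {E : Type*} [NormedAddCommGroup E]
    [InnerProductSpace ℝ E] {a z : E} (h : z ≠ a) :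
    HasFDerivAt (fun w : E => ‖a - w‖) (-innerSL ℝ (‖a - z‖⁻¹ • (a - z))) z := by
  have hne : ‖a - z‖ ≠ 0 := norm_ne_zero_iff.2 (sub_ne_zero.2 h.symm)
  have hsq := (((hasFDerivAt_id z).const_sub a).norm_sq).sqrt (pow_ne_zero 2 hne)
  simp only [id, Real.sqrt_sq (norm_nonneg _)] at hsq
  refine hsq.congr_fderiv ?_
  ext v
  simp
  field_simp
  ring

/-- If `z` is a local minimizer of `w ↦ ∑ i, ‖xᵢ - w‖` with `z ≠ xᵢ` for all `i`, then the
unit vectors pointing from `z` to the points `xᵢ` sum to zero. -/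
theorem sum_unit_vectors_eq_zero_of_isLocalMin {E : Type*} [NormedAddCommGroup E]
    [InnerProductSpace ℝ E] (n : ℕ) (x : Fin n → E) (z : E) (hz : ∀ i, z ≠ x i)
    (hmin : IsLocalMin (fun w : E => ∑ i, ‖x i - w‖) z) :
    ∑ i, (‖x i - z‖)⁻¹ • (x i - z) = 0 := by
  have h := hmin.hasFDerivAt_eq_zero
    (HasFDerivAt.fun_sum fun i _ => hasFDerivAt_norm_const_sub (hz i))
  rw [Finset.sum_neg_distrib, ← map_sum, neg_eq_zero] at h
  exact inner_self_eq_zero.1 (DFunLike.congr_fun h _)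
end

section
/- Let τ > 0, d ≥ 1, and let G_τ(x) = (4πτ)^{−d/2} exp(−‖x‖²/(4τ)) be the Gaussian heat kernel on ℝ^d. Define, for integrable measurable u : ℝ^d → [0,1], the functional F(u) = √(π/τ) ∫_{ℝ^d} u(x) (G_τ * (1 − u))(x) dx, where G_τ * (1 − u) = 1 − G_τ * u. Then F is concave: for all such u, v and all θ ∈ [0,1], F(θu + (1−θ)v) ≥ θ F(u) + (1−θ) F(v). -/
open MeasureTheory Real

/-- The Gaussian heat kernel `G_τ(x) = (4πτ)^{-d/2} exp(-‖x‖²/(4τ))` on `ℝ^d`. -/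
noncomputable def heatKernel (d : ℕ) (τ : ℝ) (x : EuclideanSpace ℝ (Fin d)) : ℝ :=
  (4 * π * τ) ^ (-(d : ℝ) / 2) * Real.exp (-‖x‖ ^ 2 / (4 * τ))

/-- Convolution with the Gaussian heat kernel. -/
noncomputable def heatConv (d : ℕ) (τ : ℝ) (u : EuclideanSpace ℝ (Fin d) → ℝ)
    (x : EuclideanSpace ℝ (Fin d)) : ℝ :=
  ∫ y, heatKernel d τ (x - y) * u y

/-- The two-phase threshold-dynamics perimeter approximation
`F(u) = √(π/τ) ∫ u (1 - G_τ * u)`, using `G_τ * (1 - u) = 1 - G_τ * u`. -/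
noncomputable def tdEnergy (d : ℕ) (τ : ℝ) (u : EuclideanSpace ℝ (Fin d) → ℝ) : ℝ :=
  Real.sqrt (π / τ) * ∫ x, u x * (1 - heatConv d τ u x)

section Gaussian

variable {V : Type*} [NormedAddCommGroup V] [InnerProductSpace ℝ V]

/-- The product of two Gaussians centred at `x` and `y` is a Gaussian centred at the midpoint. -/
lemma exp_neg_mul_sq_norm_mul_exp_neg_mul_sq_norm (a : ℝ) (x y z : V) :
    rexp (-a * ‖x - z‖ ^ 2) * rexp (-a * ‖y - z‖ ^ 2) =
      rexp (-(a / 2) * ‖x - y‖ ^ 2) * rexp (-(2 * a) * ‖z - (1 / 2 : ℝ) • (x + y)‖ ^ 2) := by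
  have hpar := parallelogram_law_with_norm ℝ (x - z) (y - z)
  have hsub : x - z - (y - z) = x - y := by abel
  have hadd : x - z + (y - z) = (-2 : ℝ) • (z - (1 / 2 : ℝ) • (x + y)) := by module
  rw [hsub, hadd, norm_smul, Real.norm_eq_abs, abs_neg, abs_two] at hpar
  rw [← Real.exp_add, ← Real.exp_add]
  congr 1
  linear_combination (a / 2) * hpar

variable [FiniteDimensional ℝ V] [MeasurableSpace V] [BorelSpace V]

lemma integrable_exp_neg_mul_sq_norm {a : ℝ} (ha : 0 < a) :
    Integrable (fun x : V => rexp (-a * ‖x‖ ^ 2)) := by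
  have h := (GaussianFourier.integrable_cexp_neg_mul_sq_norm_add (V := V) (b := (a : ℂ))
    (by simpa using ha) 0 0).norm
  refine h.congr (ae_of_all _ fun x => ?_)
  simp [Complex.norm_exp, ← Complex.ofReal_pow]

lemma integral_exp_neg_mul_sq_norm_mul (a : ℝ) (x y : V) :
    ∫ z, rexp (-a * ‖x - z‖ ^ 2) * rexp (-a * ‖y - z‖ ^ 2) =
      rexp (-(a / 2) * ‖x - y‖ ^ 2) * ∫ z : V, rexp (-(2 * a) * ‖z‖ ^ 2) := by
  simp_rw [exp_neg_mul_sq_norm_mul_exp_neg_mul_sq_norm]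
  rw [integral_const_mul,
    integral_sub_right_eq_self (fun z : V => rexp (-(2 * a) * ‖z‖ ^ 2)) ((1 / 2 : ℝ) • (x + y))]

lemma integrable_exp_neg_mul_sq_norm_mul {a : ℝ} (ha : 0 < a) (x y : V) :
    Integrable fun z => rexp (-a * ‖x - z‖ ^ 2) * rexp (-a * ‖y - z‖ ^ 2) := by
  simp_rw [exp_neg_mul_sq_norm_mul_exp_neg_mul_sq_norm]
  exact ((integrable_exp_neg_mul_sq_norm (by positivity)).comp_sub_right _).const_mul _

lemma integrable_exp_neg_mul_sq_norm_mul_prod {a : ℝ} (ha : 0 ≤ a) {f g : V → ℝ}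
    (hf : Integrable f) (hg : Integrable g) :
    Integrable fun p : V × V => rexp (-a * ‖p.1 - p.2‖ ^ 2) * (f p.1 * g p.2) := by
  refine (hf.mul_prod hg).bdd_mul (c := 1) ?_ (ae_of_all _ fun p => ?_)
  · exact Continuous.aestronglyMeasurable (by fun_prop)
  · rw [Real.norm_eq_abs, Real.abs_exp, Real.exp_le_one_iff, neg_mul, neg_nonpos]
    positivity

/-- The Gaussian kernel is positive semidefinite on integrable functions. -/
lemma integral_exp_neg_mul_sq_norm_mul_nonneg {a : ℝ} (ha : 0 < a) {w : V → ℝ}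
    (hw : Integrable w) :
    0 ≤ ∫ p : V × V, rexp (-(a / 2) * ‖p.1 - p.2‖ ^ 2) * (w p.1 * w p.2) := by
  have hC : 0 < ∫ z : V, rexp (-(2 * a) * ‖z‖ ^ 2) :=
    integral_exp_pos (integrable_exp_neg_mul_sq_norm (by positivity))
  let Φ : V × V → V → ℝ := fun p z =>
    (w p.1 * w p.2) * (rexp (-a * ‖p.1 - z‖ ^ 2) * rexp (-a * ‖p.2 - z‖ ^ 2))
  have hΦ : Integrable (Function.uncurry Φ) ((volume : Measure (V × V)).prod volume) := by
    have hmeas : AEStronglyMeasurable (Function.uncurry Φ)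
        ((volume : Measure (V × V)).prod volume) := by
      refine AEStronglyMeasurable.mul ?_ ?_
      · exact (hw.mul_prod hw).aestronglyMeasurable.comp_fst
      · exact Continuous.aestronglyMeasurable (by fun_prop)
    refine (integrable_prod_iff hmeas).2 ⟨ae_of_all _ fun p => ?_, ?_⟩
    · exact (integrable_exp_neg_mul_sq_norm_mul ha p.1 p.2).const_mul (w p.1 * w p.2)
    · have hnorm (p : V × V) : ∫ z, ‖Function.uncurry Φ (p, z)‖ =
          rexp (-(a / 2) * ‖p.1 - p.2‖ ^ 2) * (‖w p.1‖ * ‖w p.2‖) *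
            ∫ z : V, rexp (-(2 * a) * ‖z‖ ^ 2) := by
        simp only [Function.uncurry_apply_pair, Φ, norm_mul, Real.norm_eq_abs, Real.abs_exp]
        rw [integral_const_mul, integral_exp_neg_mul_sq_norm_mul]
        ring
      simp_rw [hnorm]
      exact (integrable_exp_neg_mul_sq_norm_mul_prod (by positivity) hw.norm hw.norm).mul_const _
  have hsq (z : V) : ∫ p, Φ p z = (∫ x, w x * rexp (-a * ‖x - z‖ ^ 2)) ^ 2 := by
    rw [sq, ← integral_prod_mul]
    refine integral_congr_ae (ae_of_all _ fun p => ?_)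
    simp only [Φ]
    ring
  have hswap : (∫ p : V × V, rexp (-(a / 2) * ‖p.1 - p.2‖ ^ 2) * (w p.1 * w p.2)) *
      ∫ z : V, rexp (-(2 * a) * ‖z‖ ^ 2) = ∫ z, ∫ p, Φ p z := by
    rw [← integral_integral_swap hΦ, ← integral_mul_const]
    refine integral_congr_ae (ae_of_all _ fun p => ?_)
    simp only [Φ]
    rw [integral_const_mul, integral_exp_neg_mul_sq_norm_mul]
    ring
  refine nonneg_of_mul_nonneg_left ?_ hC
  rw [hswap]
  exact integral_nonneg fun z => by rw [hsq]; positivity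

end Gaussian

lemma heatKernel_eq (d : ℕ) (τ : ℝ) (x : EuclideanSpace ℝ (Fin d)) :
    heatKernel d τ x =
      (4 * π * τ) ^ (-(d : ℝ) / 2) * rexp (-(1 / (2 * τ) / 2) * ‖x‖ ^ 2) := by
  rw [heatKernel]
  congr 2
  ring

lemma continuous_heatKernel (d : ℕ) (τ : ℝ) : Continuous (heatKernel d τ) := by
  unfold heatKernel
  fun_prop

lemma integrable_heatKernel_mul_prod {d : ℕ} {τ : ℝ} (hτ : 0 < τ)
    {f g : EuclideanSpace ℝ (Fin d) → ℝ} (hf : Integrable f) (hg : Integrable g) :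
    Integrable fun p : EuclideanSpace ℝ (Fin d) × EuclideanSpace ℝ (Fin d) =>
      f p.1 * (heatKernel d τ (p.1 - p.2) * g p.2) := by
  refine ((integrable_exp_neg_mul_sq_norm_mul_prod (a := 1 / (2 * τ) / 2) (by positivity)
    hf hg).const_mul ((4 * π * τ) ^ (-(d : ℝ) / 2))).congr (ae_of_all _ fun p => ?_)
  simp only [heatKernel_eq]
  ring

lemma integrable_mul_heatConv {d : ℕ} {τ : ℝ} (hτ : 0 < τ)
    {f g : EuclideanSpace ℝ (Fin d) → ℝ} (hf : Integrable f) (hg : Integrable g) :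
    Integrable fun x => f x * heatConv d τ g x := by
  simpa only [heatConv, integral_const_mul] using
    (integrable_heatKernel_mul_prod hτ hf hg).integral_prod_left

lemma integral_mul_heatConv_self_nonneg {d : ℕ} {τ : ℝ} (hτ : 0 < τ)
    {w : EuclideanSpace ℝ (Fin d) → ℝ} (hw : Integrable w) :
    0 ≤ ∫ x, w x * heatConv d τ w x := by
  have h := integral_prod _ (integrable_heatKernel_mul_prod hτ hw hw)
  simp only [integral_const_mul] at h
  simp only [heatConv]
  rw [← h]
  have heq (p : EuclideanSpace ℝ (Fin d) × EuclideanSpace ℝ (Fin d)) :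
      w p.1 * (heatKernel d τ (p.1 - p.2) * w p.2) = (4 * π * τ) ^ (-(d : ℝ) / 2) *
        (rexp (-(1 / (2 * τ) / 2) * ‖p.1 - p.2‖ ^ 2) * (w p.1 * w p.2)) := by
    rw [heatKernel_eq]
    ring
  simp_rw [heq]
  rw [integral_const_mul]
  exact mul_nonneg (by positivity) (integral_exp_neg_mul_sq_norm_mul_nonneg (by positivity) hw)

lemma integrable_heatKernel_mul {d : ℕ} {τ : ℝ} (hτ : 0 < τ)
    {g : EuclideanSpace ℝ (Fin d) → ℝ} (hg : Integrable g) (x : EuclideanSpace ℝ (Fin d)) :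
    Integrable fun y => heatKernel d τ (x - y) * g y := by
  refine hg.bdd_mul (c := (4 * π * τ) ^ (-(d : ℝ) / 2)) ?_ (ae_of_all _ fun y => ?_)
  · exact ((continuous_heatKernel d τ).comp (by fun_prop)).aestronglyMeasurable
  · rw [heatKernel, Real.norm_eq_abs, abs_of_nonneg (by positivity)]
    refine mul_le_of_le_one_right (by positivity) ?_
    rw [Real.exp_le_one_iff, neg_div, neg_nonpos]
    positivity

lemma heatConv_linear_combination {d : ℕ} {τ : ℝ} (hτ : 0 < τ)
    {f g : EuclideanSpace ℝ (Fin d) → ℝ} (hf : Integrable f) (hg : Integrable g) (a b : ℝ)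
    (x : EuclideanSpace ℝ (Fin d)) :
    heatConv d τ (fun y => a * f y + b * g y) x = a * heatConv d τ f x + b * heatConv d τ g x := by
  simp only [heatConv]
  rw [← integral_const_mul, ← integral_const_mul, ← integral_add
    ((integrable_heatKernel_mul hτ hf x).const_mul a)
    ((integrable_heatKernel_mul hτ hg x).const_mul b)]
  refine integral_congr_ae (ae_of_all _ fun y => ?_)
  ring

/-- The two-phase threshold-dynamics energy `F` is concave on the set of integrable
measurable functions with values in `[0, 1]`. -/
theorem tdEnergy_concave (d : ℕ) (hd : 1 ≤ d) (τ : ℝ) (hτ : 0 < τ)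
    (u v : EuclideanSpace ℝ (Fin d) → ℝ)
    (hu_meas : Measurable u) (hv_meas : Measurable v)
    (hu_int : Integrable u) (hv_int : Integrable v)
    (hu01 : ∀ x, u x ∈ Set.Icc (0 : ℝ) 1) (hv01 : ∀ x, v x ∈ Set.Icc (0 : ℝ) 1)
    (θ : ℝ) (hθ : θ ∈ Set.Icc (0 : ℝ) 1) :
    θ * tdEnergy d τ u + (1 - θ) * tdEnergy d τ v
      ≤ tdEnergy d τ (fun x => θ * u x + (1 - θ) * v x) := by
  have hint {f : EuclideanSpace ℝ (Fin d) → ℝ} (hf : Integrable f) :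
      Integrable fun x => f x * (1 - heatConv d τ f x) := by
    simp only [mul_sub, mul_one]
    exact hf.sub (integrable_mul_heatConv hτ hf hf)
  have hw_int : Integrable fun x => 1 * u x + (-1) * v x :=
    (hu_int.const_mul 1).add (hv_int.const_mul (-1))
  have hpt (x : EuclideanSpace ℝ (Fin d)) :
      (θ * u x + (1 - θ) * v x) * (1 - heatConv d τ (fun y => θ * u y + (1 - θ) * v y) x) =
        θ * (u x * (1 - heatConv d τ u x)) + (1 - θ) * (v x * (1 - heatConv d τ v x)) +
          θ * (1 - θ) *
            ((1 * u x + (-1) * v x) * heatConv d τ (fun y => 1 * u y + (-1) * v y) x) := by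
    rw [heatConv_linear_combination hτ hu_int hv_int, heatConv_linear_combination hτ hu_int hv_int]
    ring
  have hexpand : ∫ x, (θ * u x + (1 - θ) * v x) *
        (1 - heatConv d τ (fun y => θ * u y + (1 - θ) * v y) x) =
      θ * (∫ x, u x * (1 - heatConv d τ u x)) + (1 - θ) * (∫ x, v x * (1 - heatConv d τ v x)) +
        θ * (1 - θ) *
          ∫ x, (1 * u x + (-1) * v x) * heatConv d τ (fun y => 1 * u y + (-1) * v y) x := by
    simp_rw [hpt]
    rw [integral_add (((hint hu_int).const_mul _).fun_add ((hint hv_int).const_mul _))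
        ((integrable_mul_heatConv hτ hw_int hw_int).const_mul _),
      integral_add ((hint hu_int).const_mul _) ((hint hv_int).const_mul _),
      integral_const_mul, integral_const_mul, integral_const_mul]
  have hnonneg : 0 ≤ √(π / τ) * (θ * (1 - θ) *
      ∫ x, (1 * u x + (-1) * v x) * heatConv d τ (fun y => 1 * u y + (-1) * v y) x) :=
    mul_nonneg (Real.sqrt_nonneg _) (mul_nonneg (mul_nonneg hθ.1 (sub_nonneg.2 hθ.2))
      (integral_mul_heatConv_self_nonneg hτ hw_int))
  simp only [tdEnergy]
  rw [hexpand]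
  linarith
end
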